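/- Let ε > 0, let f ∈ L¹(ℍ), and suppose there exists η > 0 such that for every λ ∈ (0, η), I^ε_λ f(z,t) = 0 for almost every (z,t) ∈ ℍ. Then f = 0 almost everywhere. (Injectivity of the taming X-ray transform I^ε.) -/

import Mathlib

noncomputable section

open Complex MeasureTheory Real Set

/-- Heisenberg group multiplication on ℂ × ℝ. -/
def hmul (p q : ℂ × ℝ) : ℂ × ℝ :=
  (p.1 + q.1, p.2 + q.2 + (p.1.re * q.1.im - p.1.im * q.1.re) / 2)

/-- The model sub-Riemannian geodesic of charge `lam`:
`γ_λ(s) = (R e^{i s / R}, s R / 2)` with `R = 1/λ`. -/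
def geo (lam : ℝ) (s : ℝ) : ℂ × ℝ :=
  (((lam : ℂ))⁻¹ * Complex.exp (Complex.I * ((lam * s : ℝ) : ℂ)), s / (2 * lam))

/-- The sub-Riemannian X-ray transform `I_λ f (z,t) = ∫ f((z,t)·γ_λ(s)) ds`. -/
def xray (lam : ℝ) (f : ℂ × ℝ → ℂ) (p : ℂ × ℝ) : ℂ :=
  ∫ s : ℝ, f (hmul p (geo lam s))

/-- The model `g_ε`-geodesic of charge `lam`:
`γ^ε_λ(s) = (R e^{i s/R}, s (R² + 2ε²)/(2R))` with `R = 1/λ`. -/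
def geoE (eps lam : ℝ) (s : ℝ) : ℂ × ℝ :=
  (((lam : ℂ))⁻¹ * Complex.exp (Complex.I * ((lam * s : ℝ) : ℂ)),
    s * (1 / lam ^ 2 + 2 * eps ^ 2) * lam / 2)

/-- The taming X-ray transform `I^ε_λ f (z,t) = ∫ f((z,t)·γ^ε_λ(s)) ds`. -/
def xrayE (eps lam : ℝ) (f : ℂ × ℝ → ℂ) (p : ℂ × ℝ) : ℂ :=
  ∫ s : ℝ, f (hmul p (geoE eps lam s))

open scoped FourierTransform ContDiff ComplexConjugate

/-- An integrable function on a finite-dimensional space whose Fourier transform vanishes almost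
everywhere vanishes almost everywhere. -/
theorem ae_eq_zero_of_fourier_ae_eq_zero {V : Type*} [NormedAddCommGroup V]
    [InnerProductSpace ℝ V] [FiniteDimensional ℝ V] [MeasurableSpace V] [BorelSpace V]
    {g : V → ℂ} (hg : Integrable g) (h : ∀ᵐ v, 𝓕 g v = 0) : ∀ᵐ v, g v = 0 := by
  refine ae_eq_zero_of_integral_contDiff_smul_eq_zero hg.locallyIntegrable fun φ hφ hc => ?_
  have hc' : HasCompactSupport (fun v => (φ v : ℂ)) := hc.comp_left Complex.ofReal_zero
  have hφ' : ContDiff ℝ ∞ (fun v => (φ v : ℂ)) := Complex.ofRealCLM.contDiff.comp hφ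
  set ψ : SchwartzMap V ℂ := 𝓕⁻ (hc'.toSchwartzMap hφ') with hψ
  have h1 : ∀ v, 𝓕 (ψ : V → ℂ) v = φ v := by
    intro v
    rw [← SchwartzMap.fourier_coe, hψ, FourierTransform.fourier_fourierInv_eq]
    rfl
  have key := VectorFourier.integral_fourierIntegral_smul_eq_flip (L := innerₗ V)
    continuous_fourierChar continuous_inner (ψ.integrable (μ := volume)) hg
  rw [flip_innerₗ] at key
  calc ∫ x, φ x • g x = ∫ x, 𝓕 (ψ : V → ℂ) x • g x := by
        simp only [h1]; simp
    _ = ∫ x, ψ x • 𝓕 g x := key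
    _ = 0 := integral_eq_zero_of_ae (by
        filter_upwards [h] with v hv
        simp [hv])

theorem measurePreserving_hmul_right (q : ℂ × ℝ) :
    MeasurePreserving (fun p : ℂ × ℝ => hmul p q) := by
  refine MeasurePreserving.skew_product (f := fun z : ℂ => z + q.1)
    (g := fun z t => t + q.2 + (z.re * q.1.im - z.im * q.1.re) / 2)
    (measurePreserving_add_right volume q.1) (by fun_prop) (ae_of_all _ fun z => ?_)
  simp only [add_assoc]
  exact (measurePreserving_add_right volume _).map_eq

theorem continuous_geoE (eps lam : ℝ) : Continuous (geoE eps lam) := by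
  unfold geoE; fun_prop

theorem continuous_hmul : Continuous fun x : (ℂ × ℝ) × (ℂ × ℝ) => hmul x.1 x.2 := by
  unfold hmul; fun_prop

theorem measurePreserving_geoE_shear (eps lam : ℝ) (μ : Measure ℝ) [SFinite μ] :
    MeasurePreserving (fun x : ℝ × (ℂ × ℝ) => (x.1, hmul x.2 (geoE eps lam x.1)))
      (μ.prod volume) (μ.prod volume) := by
  refine MeasurePreserving.skew_product (f := id) (g := fun s p => hmul p (geoE eps lam s))
    (MeasurePreserving.id μ) ?_ (ae_of_all _ fun s => (measurePreserving_hmul_right _).map_eq)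
  have := continuous_hmul.comp
    (continuous_snd.prodMk ((continuous_geoE eps lam).comp (continuous_fst (X := ℝ) (Y := ℂ × ℝ))))
  exact this.measurable

theorem hmul_hmul_neg (p q : ℂ × ℝ) : hmul (hmul p q) (-q) = p := by
  refine Prod.ext (by simp [hmul]) ?_
  simp only [hmul, Prod.fst_neg, Prod.snd_neg, Complex.add_re, Complex.add_im, Complex.neg_re,
    Complex.neg_im]
  ring

/-- A strip in the `s` direction is a fundamental domain for the translations by the multiples
of `(S, (0, -T))`. -/
theorem isAddFundamentalDomain_fst {S : ℝ} (hS : 0 < S) (T : ℝ) :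
    IsAddFundamentalDomain (AddSubgroup.zmultiples ((S, ((0 : ℂ), -T)) : ℝ × (ℂ × ℝ)))
      (Ioc 0 S ×ˢ (univ : Set (ℂ × ℝ))) := by
  refine IsAddFundamentalDomain.mk' (measurableSet_Ioc.prod MeasurableSet.univ).nullMeasurableSet
    fun x => ?_
  set v : ℝ × (ℂ × ℝ) := (S, (0, -T)) with hv
  have hinj : Function.Injective (fun n : ℤ => n • v) := fun m n h => by
    simpa [hv, hS.ne'] using congrArg Prod.fst h
  have : Function.Bijective (codRestrict (fun n : ℤ => n • v) (AddSubgroup.zmultiples v)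
      fun n => ⟨n, rfl⟩) := (Equiv.ofInjective _ hinj).bijective
  refine this.existsUnique_iff.2 ?_
  simpa [AddSubgroup.vadd_def, hv, add_comm] using existsUnique_add_zsmul_mem_Ioc hS x.1 0

/-- A strip in the `t` direction is a fundamental domain for the translations by the multiples
of `(S, (0, -T))`. -/
theorem isAddFundamentalDomain_snd {T : ℝ} (hT : 0 < T) (S : ℝ) :
    IsAddFundamentalDomain (AddSubgroup.zmultiples ((S, ((0 : ℂ), -T)) : ℝ × (ℂ × ℝ)))
      ((univ : Set ℝ) ×ˢ ((univ : Set ℂ) ×ˢ Ioc 0 T)) := by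
  refine IsAddFundamentalDomain.mk' (MeasurableSet.univ.prod
    (MeasurableSet.univ.prod measurableSet_Ioc)).nullMeasurableSet fun x => ?_
  set v : ℝ × (ℂ × ℝ) := (S, (0, -T)) with hv
  have hinj : Function.Injective (fun n : ℤ => n • v) := fun m n h => by
    simpa [hv, hT.ne'] using congrArg (fun y => y.2.2) h
  have : Function.Bijective (codRestrict (fun n : ℤ => n • v) (AddSubgroup.zmultiples v)
      fun n => ⟨n, rfl⟩) := (Equiv.ofInjective _ hinj).bijective
  refine this.existsUnique_iff.2 ?_
  have h := existsUnique_sub_zsmul_mem_Ioc hT x.2.2 0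
  simpa [AddSubgroup.vadd_def, hv, sub_eq_neg_add] using h

theorem geoE_add_period {lam : ℝ} (hlam : 0 < lam) (eps s : ℝ) :
    geoE eps lam (s + 2 * π / lam) =
      geoE eps lam s + (0, π * (1 / lam ^ 2 + 2 * eps ^ 2)) := by
  refine Prod.ext ?_ ?_
  · have h : Complex.I * ((lam * (s + 2 * π / lam) : ℝ) : ℂ)
        = Complex.I * ((lam * s : ℝ) : ℂ) + 2 * π * Complex.I := by
      have h' : lam * (s + 2 * π / lam) = lam * s + 2 * π := by field_simp
      rw [h']; push_cast; ring
    simp only [geoE, h, Complex.exp_add, Complex.exp_two_pi_mul_I, Prod.fst_add, mul_one, add_zero]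
  · simp only [geoE, Prod.snd_add]
    field_simp

/-- Pairing the vanishing transform with a character in `t` times a bounded function of `z`, and
unfolding the central period of the geodesic. -/
theorem integral_mul_orbit_eq_zero {eps lam : ℝ} (hlam : 0 < lam) {f : ℂ × ℝ → ℂ}
    (hf : Integrable f) (hI : ∀ᵐ p : ℂ × ℝ, xrayE eps lam f p = 0) {τ : ℝ} {k : ℕ}
    (hτ : τ * (1 / lam ^ 2 + 2 * eps ^ 2) = 2 * k) {φ : ℂ → ℂ} (hφ : Continuous φ) {C : ℝ}
    (hC : ∀ z, ‖φ z‖ ≤ C) :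
    ∫ q, f q * ∫ s in Ioc 0 (2 * π / lam), φ (hmul q (-geoE eps lam s)).1 *
      cexp (-(I * τ * (hmul q (-geoE eps lam s)).2)) = 0 := by
  set S : ℝ := 2 * π / lam with hS
  set T : ℝ := π * (1 / lam ^ 2 + 2 * eps ^ 2) with hT
  have hSpos : 0 < S := by positivity
  have hTpos : 0 < T := by positivity
  set γ := geoE eps lam with hγ
  set χ : ℂ × ℝ → ℂ := fun p => φ p.1 * cexp (-(I * τ * p.2)) with hχ
  have hχc : Continuous χ := by rw [hχ]; fun_prop
  have hχb : ∀ p, ‖χ p‖ ≤ C := fun p => by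
    have : ‖cexp (-(I * τ * p.2))‖ = 1 := by
      rw [Complex.norm_exp]; simp
    simpa [hχ, this] using hC p.1
  set μ : Measure ℝ := volume.restrict (Ioc 0 S) with hμ
  have : IsFiniteMeasure μ := by rw [hμ]; infer_instance
  set K : ℝ × (ℂ × ℝ) → ℂ := fun x => f x.2 * χ (hmul x.2 (-γ x.1)) with hK
  set H : ℝ × (ℂ × ℝ) → ℂ := fun x => f (hmul x.2 (γ x.1)) * χ x.2 with hH
  have hKint : Integrable K (μ.prod volume) := by
    refine Integrable.mul_bdd (hf.comp_snd μ) ?_ (ae_of_all _ fun x => hχb _)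
    have h1 : Continuous fun x : ℝ × (ℂ × ℝ) => hmul x.2 (-γ x.1) :=
      continuous_hmul.comp (continuous_snd.prodMk
        ((continuous_geoE eps lam).neg.comp continuous_fst))
    exact (hχc.comp h1).aestronglyMeasurable
  have hmp := measurePreserving_geoE_shear eps lam μ
  have hHK : H = K ∘ fun x : ℝ × (ℂ × ℝ) => (x.1, hmul x.2 (geoE eps lam x.1)) := by
    funext x
    simp only [hH, hK, Function.comp, hγ, hmul_hmul_neg]
  have hHint : Integrable H (μ.prod volume) := by
    rw [hHK]
    exact hmp.integrable_comp_of_integrable hKint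
  have hHeq : ∫ x, H x ∂(μ.prod volume) = ∫ x, K x ∂(μ.prod volume) := by
    rw [hHK]
    conv_rhs => rw [← hmp.map_eq]
    rw [integral_map hmp.measurable.aemeasurable]
    · rfl
    · rw [hmp.map_eq]; exact hKint.aestronglyMeasurable
  have hper : Function.Periodic H (S, ((0 : ℂ), -T)) := by
    intro x
    have h1 : hmul (x.2 + (0, -T)) (γ (x.1 + S)) = hmul x.2 (γ x.1) := by
      rw [hγ, hS, geoE_add_period hlam]
      refine Prod.ext ?_ ?_
      · simp [hmul]
      · simp [hmul]; ring
    have h2 : χ (x.2 + (0, -T)) = χ x.2 := by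
      have h3 : -(I * τ * ((x.2.2 + -T : ℝ) : ℂ)) = -(I * τ * x.2.2) + k * (2 * π * I) := by
        have h4 : ((τ * T : ℝ) : ℂ) = 2 * π * k := by
          have : τ * T = 2 * π * k := by rw [hT]; linear_combination π * hτ
          rw [this]; push_cast; ring
        push_cast at h4 ⊢
        linear_combination I * h4
      simp only [hχ, Prod.fst_add, Prod.snd_add, add_zero, h3, Complex.exp_add,
        Complex.exp_nat_mul_two_pi_mul_I, mul_one]
    simp only [hH, Prod.fst_add, Prod.snd_add, h1, h2]
  have hinv := hper.map_vadd_zmultiples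
  have hd1 := isAddFundamentalDomain_fst hSpos T
  have hd2 := isAddFundamentalDomain_snd hTpos S
  have hr1 : (volume : Measure (ℝ × (ℂ × ℝ))).restrict (Ioc 0 S ×ˢ univ) = μ.prod volume := by
    rw [Measure.volume_eq_prod, ← Measure.prod_restrict, Measure.restrict_univ]
  have hr2 : (volume : Measure (ℝ × (ℂ × ℝ))).restrict (univ ×ˢ (univ ×ˢ Ioc 0 T))
      = (volume : Measure ℝ).prod
        ((volume : Measure (ℂ × ℝ)).restrict (univ ×ˢ Ioc 0 T)) := by
    rw [Measure.volume_eq_prod, ← Measure.prod_restrict, Measure.restrict_univ]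
  have : (volume : Measure (ℂ × ℝ)).IsAddLeftInvariant :=
    Measure.prod.instIsAddLeftInvariant
  have : (volume : Measure (ℝ × (ℂ × ℝ))).IsAddLeftInvariant :=
    Measure.prod.instIsAddLeftInvariant
  have hint2 : Integrable H ((volume : Measure ℝ).prod
      ((volume : Measure (ℂ × ℝ)).restrict (univ ×ˢ Ioc 0 T))) := by
    rw [← hr2]
    refine (hd1.integrableOn_iff hd2 hinv).1 ?_
    rw [IntegrableOn, hr1]; exact hHint
  have heq := hd1.setIntegral_eq hd2 hinv
  rw [hr1, hr2, hHeq, integral_prod_symm _ hKint, integral_prod_symm _ hint2] at heq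
  have h0 : ∫ p in (univ ×ˢ Ioc 0 T : Set (ℂ × ℝ)), ∫ s, H (s, p) = 0 := by
    refine integral_eq_zero_of_ae (ae_restrict_of_ae ?_)
    filter_upwards [hI] with p hp
    rw [xrayE] at hp
    simp only [hH, integral_mul_const, hγ, hp, zero_mul, Pi.zero_apply]
  rw [h0] at heq
  rw [← heq]
  refine integral_congr_ae (ae_of_all _ fun q => ?_)
  simp only [hK, integral_const_mul, hμ, hχ]

theorem integral_exp_int_mul_I (n : ℤ) :
    ∫ θ in (0 : ℝ)..2 * π, cexp (n * (θ * I)) = if n = 0 then 2 * π else 0 := by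
  split_ifs with h
  · simp [h]
  · have hc : (n : ℂ) * I ≠ 0 := mul_ne_zero (Int.cast_ne_zero.2 h) I_ne_zero
    have h1 : ∀ θ : ℝ, (n : ℂ) * (θ * I) = n * I * θ := fun θ => by ring
    simp only [h1]
    rw [integral_exp_mul_complex hc]
    have h2 : (n : ℂ) * I * ((2 * π : ℝ) : ℂ) = n * (2 * π * I) := by push_cast; ring
    rw [h2, Complex.exp_int_mul_two_pi_mul_I]
    simp

theorem hasSum_integral_exp_mul_exp_exp (κ : ℂ) (n : ℤ) :
    HasSum (fun j : ℕ => κ ^ j / (j.factorial : ℂ) * if n + j = 0 then (2 * π : ℂ) else 0)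
      (∫ θ in (0 : ℝ)..2 * π, cexp (n * (θ * I)) * cexp (κ * cexp (θ * I))) := by
  have key := intervalIntegral.hasSum_integral_of_dominated_convergence (μ := volume)
    (a := 0) (b := 2 * π)
    (F := fun (j : ℕ) (θ : ℝ) => κ ^ j / (j.factorial : ℂ) * cexp ((n + j : ℤ) * (θ * I)))
    (f := fun θ : ℝ => cexp (n * (θ * I)) * cexp (κ * cexp (θ * I)))
    (fun j _ => ‖κ‖ ^ j / (j.factorial : ℝ)) (fun j => by fun_prop)
    (fun j => ae_of_all _ fun θ _ => ?_)
    (ae_of_all _ fun θ _ => Real.summable_pow_div_factorial _) (by simp)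
    (ae_of_all _ fun θ _ => ?_)
  · convert! key using 2 with j
    rw [intervalIntegral.integral_const_mul, integral_exp_int_mul_I]
    split_ifs <;> simp
  · rw [norm_mul, norm_div, norm_pow, Complex.norm_natCast, Complex.norm_exp]
    simp
  · have h := (NormedSpace.expSeries_div_hasSum_exp (κ * cexp (θ * I))).mul_left
      (cexp (n * (θ * I)))
    rw [← Complex.exp_eq_exp_ℂ] at h
    convert! h using 2 with j
    have h2 : ((n + j : ℤ) : ℂ) * (θ * I) = n * (θ * I) + j * (θ * I) := by push_cast; ring
    rw [h2, Complex.exp_add, mul_pow, ← Complex.exp_nat_mul]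
    ring

theorem integral_exp_mul_exp_exp_of_pos (κ : ℂ) {n : ℤ} (hn : 0 < n) :
    ∫ θ in (0 : ℝ)..2 * π, cexp (n * (θ * I)) * cexp (κ * cexp (θ * I)) = 0 := by
  refine (hasSum_integral_exp_mul_exp_exp κ n).unique ?_
  convert! hasSum_zero (α := ℂ) (β := ℕ) using 2 with j
  rw [if_neg (by omega), mul_zero]

theorem integral_exp_neg_mul_exp_exp (κ : ℂ) (m : ℕ) :
    ∫ θ in (0 : ℝ)..2 * π, cexp ((-m : ℤ) * (θ * I)) * cexp (κ * cexp (θ * I)) =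
      2 * π * (κ ^ m / (m.factorial : ℂ)) := by
  refine (hasSum_integral_exp_mul_exp_exp κ (-m)).unique ?_
  convert! hasSum_ite_eq m (2 * π * (κ ^ m / (m.factorial : ℂ))) using 2 with j
  by_cases h : j = m
  · subst h; simp; ring
  · rw [if_neg (by omega), if_neg h, mul_zero]

theorem integral_circle_binomial (κ W r : ℂ) (k j : ℕ) :
    ∫ θ in (0 : ℝ)..2 * π, cexp (k * (θ * I)) * (W - r * cexp (-(θ * I))) ^ (k + j) *
        cexp (κ * cexp (θ * I)) =
      2 * π * (-r) ^ k * ∑ m ∈ Finset.range (j + 1),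
        ((k + j).choose (k + m) : ℂ) / (m.factorial : ℂ) * (-r * κ) ^ m * W ^ (j - m) := by
  have hexp : ∀ θ : ℝ, cexp (k * (θ * I)) * (W - r * cexp (-(θ * I))) ^ (k + j) *
        cexp (κ * cexp (θ * I)) = ∑ i ∈ Finset.range (k + (j + 1)),
        ((-r) ^ i * W ^ (k + j - i) * ((k + j).choose i : ℂ)) *
          (cexp ((k - i : ℤ) * (θ * I)) * cexp (κ * cexp (θ * I))) := by
    intro θ
    rw [sub_eq_neg_add, add_pow, Finset.mul_sum, Finset.sum_mul]
    refine Finset.sum_congr rfl fun i _ => ?_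
    have h2 : ((k - i : ℤ) : ℂ) * (θ * I) = k * (θ * I) + i * (-(θ * I)) := by push_cast; ring
    rw [h2, Complex.exp_add, Complex.exp_nat_mul _ i, ← neg_mul, mul_pow]
    ring
  simp only [hexp]
  rw [intervalIntegral.integral_finsetSum
    fun i _ => Continuous.intervalIntegrable (by fun_prop) _ _]
  simp only [intervalIntegral.integral_const_mul]
  rw [Finset.sum_range_add, Finset.sum_eq_zero, zero_add, Finset.mul_sum]
  · refine Finset.sum_congr rfl fun m hm => ?_
    have h1 : ((k : ℤ) - ((k + m : ℕ) : ℤ)) = -m := by push_cast; ring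
    rw [h1, integral_exp_neg_mul_exp_exp, Nat.add_sub_add_left, mul_pow (-r) κ, pow_add]
    ring
  · intro i hi
    rw [integral_exp_mul_exp_exp_of_pos κ (by have := Finset.mem_range.1 hi; omega), mul_zero]

theorem orbit_integrand_eq {eps lam τ : ℝ} {k : ℕ}
    (hτ : τ * (1 / lam ^ 2 + 2 * eps ^ 2) = 2 * k) (α : ℂ) (b : ℕ) (q : ℂ × ℝ) (s : ℝ) :
    cexp (-(τ / 4) * ((hmul q (-geoE eps lam s)).1 * conj (hmul q (-geoE eps lam s)).1) +
        α * (hmul q (-geoE eps lam s)).1) * conj (hmul q (-geoE eps lam s)).1 ^ b *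
      cexp (-(I * τ * (hmul q (-geoE eps lam s)).2)) =
    (cexp (-(τ / 4) * (lam : ℂ)⁻¹ ^ 2) *
      (cexp (-(I * τ * q.2)) * cexp (-(τ / 4) * (q.1 * conj q.1) + α * q.1))) *
      (cexp (k * ((lam * s : ℝ) * I)) *
        (conj q.1 - (lam : ℂ)⁻¹ * cexp (-((lam * s : ℝ) * I))) ^ b *
        cexp ((lam : ℂ)⁻¹ * (τ / 2 * conj q.1 - α) * cexp ((lam * s : ℝ) * I))) := by
  obtain ⟨w, u⟩ := q
  set θ : ℝ := lam * s with hθ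
  set ζ : ℂ := cexp (θ * I) with hζ
  set ζ' : ℂ := cexp (-(θ * I)) with hζ'
  have hconj : conj ζ = ζ' := by
    rw [hζ, hζ', ← Complex.exp_conj]; simp
  have hone : ζ * ζ' = 1 := by rw [hζ, hζ', ← Complex.exp_add]; simp
  have h1 : (hmul (w, u) (-geoE eps lam s)).1 = w - (lam : ℂ)⁻¹ * ζ := by
    simp only [hmul, geoE, Prod.fst_neg, ← hθ, hζ, mul_comm I, sub_eq_add_neg]
  have h1' : conj (hmul (w, u) (-geoE eps lam s)).1 = conj w - (lam : ℂ)⁻¹ * ζ' := by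
    rw [h1, map_sub, map_mul, hconj, ← Complex.ofReal_inv, Complex.conj_ofReal]
  have him : ∀ v : ℂ, (((w.re * v.im - w.im * v.re : ℝ)) : ℂ) =
      (conj w * v - w * conj v) / (2 * I) := by
    intro v
    rw [eq_div_iff (by simp)]
    apply Complex.ext <;> simp
    ring
  have h2 : ((hmul (w, u) (-geoE eps lam s)).2 : ℂ) =
      u - s * (1 / (lam : ℂ) ^ 2 + 2 * eps ^ 2) * lam / 2 -
        (lam : ℂ)⁻¹ * (conj w * ζ - w * ζ') / (4 * I) := by
    have h3 : (hmul (w, u) (-geoE eps lam s)).2 =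
        u - s * (1 / lam ^ 2 + 2 * eps ^ 2) * lam / 2 -
        (w.re * ((lam : ℂ)⁻¹ * ζ).im - w.im * ((lam : ℂ)⁻¹ * ζ).re) / 2 := by
      simp only [hmul, geoE, Prod.snd_neg, Prod.fst_neg, ← hθ, hζ, mul_comm I, Complex.neg_re,
        Complex.neg_im]
      ring
    rw [h3]
    have h4 := him ((lam : ℂ)⁻¹ * ζ)
    rw [map_mul, hconj, ← Complex.ofReal_inv, Complex.conj_ofReal] at h4
    push_cast at h4 ⊢
    rw [h4]
    field_simp
    ring
  have hI2 : I * I = -1 := I_mul_I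
  have hτ' : (τ : ℂ) * (1 / (lam : ℂ) ^ 2 + 2 * eps ^ 2) = 2 * k := by exact_mod_cast hτ
  have h5 : -(τ / 4) * ((w - (lam : ℂ)⁻¹ * ζ) * (conj w - (lam : ℂ)⁻¹ * ζ')) +
      α * (w - (lam : ℂ)⁻¹ * ζ) + -(I * τ * (u - s * (1 / (lam : ℂ) ^ 2 + 2 * eps ^ 2) * lam / 2 -
        (lam : ℂ)⁻¹ * (conj w * ζ - w * ζ') / (4 * I))) =
      -(τ / 4) * (lam : ℂ)⁻¹ ^ 2 + (-(I * τ * u) + (-(τ / 4) * (w * conj w) + α * w)) +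
        (k * (θ * I) + (lam : ℂ)⁻¹ * (τ / 2 * conj w - α) * ζ) := by
    have h6 : (lam : ℂ)⁻¹ * (conj w * ζ - w * ζ') / (4 * I) =
        - I * (lam : ℂ)⁻¹ * (conj w * ζ - w * ζ') / 4 := by
      rw [div_eq_mul_inv, mul_inv, Complex.inv_I]
      ring
    have h7 : (θ : ℂ) = lam * s := by rw [hθ]; push_cast; ring
    rw [h6, h7]
    linear_combination (-(τ / 4) * (lam : ℂ)⁻¹ ^ 2) * hone + (I * s * lam / 2) * hτ' +
      (-τ * (lam : ℂ)⁻¹ * (conj w * ζ - w * ζ') / 4) * hI2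
  rw [h1', h1, h2]
  calc _ = cexp (-(τ / 4) * ((w - (lam : ℂ)⁻¹ * ζ) * (conj w - (lam : ℂ)⁻¹ * ζ')) +
      α * (w - (lam : ℂ)⁻¹ * ζ) + -(I * τ * (u - s * (1 / (lam : ℂ) ^ 2 + 2 * eps ^ 2) * lam / 2 -
        (lam : ℂ)⁻¹ * (conj w * ζ - w * ζ') / (4 * I)))) * (conj w - (lam : ℂ)⁻¹ * ζ') ^ b := by
        rw [Complex.exp_add _ (-(I * τ * _))]; ring
    _ = _ := by
        rw [h5]
        simp only [Complex.exp_add]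
        ring

theorem exp_neg_sq_add_le {τ : ℝ} (hτ : 0 < τ) (A x : ℝ) :
    rexp (-(τ / 4) * x ^ 2 + A * x) ≤ rexp (A ^ 2 / τ) := by
  refine Real.exp_le_exp.2 ?_
  rw [le_div_iff₀ hτ]
  nlinarith [sq_nonneg (τ * x / 2 - A)]

theorem norm_gaussian (τ : ℝ) (α z : ℂ) :
    ‖cexp (-(τ / 4) * (z * conj z) + α * z)‖ ≤ rexp (-(τ / 4) * ‖z‖ ^ 2 + ‖α‖ * ‖z‖) := by
  rw [Complex.norm_exp, Complex.mul_conj, Complex.normSq_eq_norm_sq]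
  refine Real.exp_le_exp.2 ?_
  have h1 : (-((τ : ℂ) / 4) * ((‖z‖ ^ 2 : ℝ) : ℂ)).re = -(τ / 4) * ‖z‖ ^ 2 := by
    have : -((τ : ℂ) / 4) * ((‖z‖ ^ 2 : ℝ) : ℂ) = ((-(τ / 4) * ‖z‖ ^ 2 : ℝ) : ℂ) := by
      push_cast; ring
    rw [this, Complex.ofReal_re]
  rw [Complex.add_re, h1, ← norm_mul]
  gcongr
  exact Complex.re_le_norm _

theorem norm_gaussian_mul_pow_le {τ : ℝ} (hτ : 0 < τ) (α : ℂ) (j : ℕ) (z : ℂ) :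
    ‖cexp (-(τ / 4) * (z * conj z) + α * z) * conj z ^ j‖ ≤
      rexp ((‖α‖ + 1) ^ 2 / τ) * j.factorial := by
  have h1 : ‖z‖ ^ j ≤ rexp ‖z‖ * j.factorial := by
    have := Real.pow_div_factorial_le_exp _ (norm_nonneg z) j
    rwa [div_le_iff₀ (by positivity)] at this
  calc _ = ‖cexp (-(τ / 4) * (z * conj z) + α * z)‖ * ‖z‖ ^ j := by
        rw [norm_mul, norm_pow, Complex.norm_conj]
    _ ≤ rexp (-(τ / 4) * ‖z‖ ^ 2 + ‖α‖ * ‖z‖) * (rexp ‖z‖ * j.factorial) :=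
        mul_le_mul (norm_gaussian τ α z) h1 (by positivity) (by positivity)
    _ = rexp (-(τ / 4) * ‖z‖ ^ 2 + (‖α‖ + 1) * ‖z‖) * j.factorial := by
        rw [← mul_assoc, ← Real.exp_add]; ring_nf
    _ ≤ _ := mul_le_mul_of_nonneg_right (exp_neg_sq_add_le hτ _ _) (by positivity)

/-- The weight `e^{-iτt} e^{-τ|z|²/4 + αz}` on the Heisenberg group. -/
def fockWeight (τ : ℝ) (α : ℂ) (q : ℂ × ℝ) : ℂ :=
  cexp (-(I * τ * q.2)) * cexp (-(τ / 4) * (q.1 * conj q.1) + α * q.1)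

theorem continuous_fockWeight (τ : ℝ) (α : ℂ) : Continuous (fockWeight τ α) := by
  unfold fockWeight
  have : Continuous fun q : ℂ × ℝ => conj q.1 := Complex.continuous_conj.comp continuous_fst
  fun_prop

theorem norm_exp_neg_I_mul (τ t : ℝ) : ‖cexp (-(I * τ * t))‖ = 1 := by
  rw [Complex.norm_exp]; simp

theorem integrable_mul_fockWeight_mul_pow {f : ℂ × ℝ → ℂ} (hf : Integrable f) {τ : ℝ}
    (hτ : 0 < τ) (α : ℂ) (j : ℕ) :
    Integrable fun q => f q * fockWeight τ α q * conj q.1 ^ j := by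
  simp only [mul_assoc]
  refine hf.mul_bdd (c := rexp ((‖α‖ + 1) ^ 2 / τ) * j.factorial) ?_ (ae_of_all _ fun q => ?_)
  · exact ((continuous_fockWeight τ α).mul
      ((Complex.continuous_conj.comp continuous_fst).pow j)).aestronglyMeasurable
  · rw [fockWeight, mul_assoc, norm_mul, norm_exp_neg_I_mul, one_mul]
    exact norm_gaussian_mul_pow_le hτ α j q.1

theorem integral_fockWeight_mul_sum_eq_zero {eps lam : ℝ} (hlam : 0 < lam) {f : ℂ × ℝ → ℂ}
    (hf : Integrable f) (hI : ∀ᵐ p : ℂ × ℝ, xrayE eps lam f p = 0) {τ : ℝ} (hτ0 : 0 < τ) {k : ℕ}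
    (hτ : τ * (1 / lam ^ 2 + 2 * eps ^ 2) = 2 * k) (α : ℂ) (j : ℕ) :
    ∫ q, f q * fockWeight τ α q * ∑ m ∈ Finset.range (j + 1),
      ((k + j).choose (k + m) : ℂ) / (m.factorial : ℂ) *
        ((lam : ℂ)⁻¹ ^ 2 * (α - τ / 2 * conj q.1)) ^ m * conj q.1 ^ (j - m) = 0 := by
  have h := integral_mul_orbit_eq_zero hlam hf hI hτ
    (φ := fun z => cexp (-(τ / 4) * (z * conj z) + α * z) * conj z ^ (k + j))
    (by have := Complex.continuous_conj; fun_prop) (norm_gaussian_mul_pow_le hτ0 α (k + j))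
  set c : ℂ := cexp (-(τ / 4) * (lam : ℂ)⁻¹ ^ 2) * ((lam : ℂ)⁻¹ * (2 * π * (-(lam : ℂ)⁻¹) ^ k))
    with hc
  have hlam' : (lam : ℂ) ≠ 0 := Complex.ofReal_ne_zero.2 hlam.ne'
  have hpi : (π : ℂ) ≠ 0 := Complex.ofReal_ne_zero.2 Real.pi_ne_zero
  have hc0 : c ≠ 0 := by
    rw [hc]
    exact mul_ne_zero (Complex.exp_ne_zero _) (mul_ne_zero (inv_ne_zero hlam')
      (mul_ne_zero (mul_ne_zero two_ne_zero hpi) (pow_ne_zero _ (neg_ne_zero.2 (inv_ne_zero hlam')))))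
  refine (mul_eq_zero.1 (Eq.trans ?_ h)).resolve_left hc0
  rw [← integral_const_mul]
  refine integral_congr_ae (ae_of_all _ fun q => ?_)
  simp only [orbit_integrand_eq hτ]
  rw [integral_const_mul, ← intervalIntegral.integral_of_le (by positivity),
    intervalIntegral.integral_comp_mul_left (fun θ : ℝ => cexp (k * (θ * I)) *
        (conj q.1 - (lam : ℂ)⁻¹ * cexp (-(θ * I))) ^ (k + j) *
        cexp ((lam : ℂ)⁻¹ * (τ / 2 * conj q.1 - α) * cexp (θ * I))) hlam.ne', mul_zero,
    mul_div_cancel₀ _ hlam.ne', integral_circle_binomial, Complex.real_smul, Complex.ofReal_inv]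
  have hs : ∀ m, (-(lam : ℂ)⁻¹ * ((lam : ℂ)⁻¹ * (τ / 2 * conj q.1 - α))) ^ m =
      ((lam : ℂ)⁻¹ ^ 2 * (α - τ / 2 * conj q.1)) ^ m := fun m => by congr 1; ring
  simp only [hs, hc, fockWeight]
  ring

theorem eventually_sum_choose_mul_pow_ne_zero {c : ℝ} (hc : 0 ≤ c) (j : ℕ) :
    ∀ᶠ k : ℕ in Filter.atTop, ∑ m ∈ Finset.range (j + 1),
      ((k + j).choose (k + m) : ℝ) / (m.factorial : ℝ) * (c - k) ^ m ≠ 0 := by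
  set P : Polynomial ℝ := ∑ m ∈ Finset.range (j + 1),
    Polynomial.C (((j - m).factorial : ℝ)⁻¹ / (m.factorial : ℝ)) *
      (descPochhammer ℝ (j - m)).comp (Polynomial.X + Polynomial.C (j : ℝ)) *
      (Polynomial.C c - Polynomial.X) ^ m with hP
  have hPc : P.eval c ≠ 0 := by
    rw [hP, Polynomial.eval_finsetSum, Finset.sum_eq_single 0]
    · have h : 0 < (descPochhammer ℝ j).eval (c + j) := descPochhammer_pos (by linarith)
      simp [h.ne', Nat.factorial_ne_zero]
    · intro m _ hm
      simp [hm]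
    · simp
  have hP0 : P ≠ 0 := fun h => hPc (by rw [h, Polynomial.eval_zero])
  have hev := tendsto_natCast_atTop_atTop.eventually (Polynomial.eventually_atTop_not_isRoot P hP0)
  filter_upwards [hev] with k hk
  convert! hk using 1
  rw [Polynomial.IsRoot, hP, Polynomial.eval_finsetSum]
  congr! 2 with m hm
  have hm' : m ≤ j := Nat.lt_succ_iff.1 (Finset.mem_range.1 hm)
  have h1 : (k + j).choose (k + m) = (k + j).choose (j - m) := by
    rw [← Nat.choose_symm (by omega : k + m ≤ k + j)]
    congr 1; omega
  have h2 : (descPochhammer ℝ (j - m)).eval ((k : ℝ) + j) =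
      (j - m).factorial * ((k + j).choose (j - m) : ℝ) := by
    rw [← Nat.cast_add, descPochhammer_eval_eq_descFactorial, Nat.descFactorial_eq_factorial_mul_choose]
    push_cast; ring
  have h3 : ((j - m).factorial : ℝ) ≠ 0 := by positivity
  simp only [Polynomial.eval_mul, Polynomial.eval_C, Polynomial.eval_comp, Polynomial.eval_add,
    Polynomial.eval_X, Polynomial.eval_pow, Polynomial.eval_sub, h2, h1]
  field_simp

theorem sum_eq_leading_add_lower (a : ℕ → ℂ) (r α β : ℂ) (j : ℕ) :
    ∃ d : ℕ → ℂ, ∀ W : ℂ, ∑ m ∈ Finset.range (j + 1), a m * (r * (α - β * W)) ^ m * W ^ (j - m) =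
      (∑ m ∈ Finset.range (j + 1), a m * (-(r * β)) ^ m) * W ^ j +
        ∑ i ∈ Finset.range j, d i * W ^ i := by
  set L : Polynomial ℂ :=
    Polynomial.C r * (Polynomial.C α - Polynomial.C β * Polynomial.X) with hL
  set Q : Polynomial ℂ := ∑ m ∈ Finset.range (j + 1),
    Polynomial.C (a m) * L ^ m * Polynomial.X ^ (j - m) with hQ
  have hLdeg : L.natDegree ≤ 1 := by rw [hL]; compute_degree
  have hL1 : L.coeff 1 = -(r * β) := by rw [hL]; simp [Polynomial.coeff_C]
  have hLm : ∀ m, (L ^ m).natDegree ≤ m := fun m => by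
    simpa using Polynomial.natDegree_pow_le_of_le m hLdeg
  have hLc : ∀ m, (L ^ m).coeff m = (-(r * β)) ^ m := fun m => by
    have := Polynomial.coeff_pow_of_natDegree_le hLdeg (m := m)
    rwa [mul_one, hL1] at this
  have hdeg : Q.natDegree ≤ j := by
    refine Polynomial.natDegree_sum_le_of_forall_le _ _ fun m hm => ?_
    have hm' : m ≤ j := Nat.lt_succ_iff.1 (Finset.mem_range.1 hm)
    have h1 : (Polynomial.C (a m) * L ^ m).natDegree ≤ m :=
      (Polynomial.natDegree_C_mul_le _ _).trans (hLm m)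
    have h2 := Polynomial.natDegree_mul_le_of_le h1
      (Polynomial.natDegree_X_pow_le (R := ℂ) (j - m))
    omega
  have hcoeff : Q.coeff j = ∑ m ∈ Finset.range (j + 1), a m * (-(r * β)) ^ m := by
    rw [hQ, Polynomial.finsetSum_coeff]
    refine Finset.sum_congr rfl fun m hm => ?_
    have hm' : m ≤ j := Nat.lt_succ_iff.1 (Finset.mem_range.1 hm)
    rw [Polynomial.coeff_mul_X_pow', if_pos (Nat.sub_le _ _), Nat.sub_sub_self hm',
      Polynomial.coeff_C_mul, hLc]
  refine ⟨Q.coeff, fun W => ?_⟩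
  have h := Polynomial.eval_eq_sum_range' (Nat.lt_succ_of_le hdeg) W
  rw [Finset.sum_range_succ, hcoeff] at h
  rw [add_comm (_ * W ^ j), ← h, hQ, Polynomial.eval_finsetSum]
  refine Finset.sum_congr rfl fun m _ => ?_
  simp [hL]

/-- All the antiholomorphic moments of the weighted function vanish. -/
theorem integral_mul_fockWeight_mul_pow_eq_zero {eps : ℝ} {f : ℂ × ℝ → ℂ} (hf : Integrable f)
    {η : ℝ} (hη : 0 < η)
    (hI : ∀ lam ∈ Set.Ioo (0 : ℝ) η, ∀ᵐ p : ℂ × ℝ, xrayE eps lam f p = 0) {τ : ℝ} (hτ : 0 < τ)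
    (α : ℂ) (j : ℕ) : ∫ q, f q * fockWeight τ α q * conj q.1 ^ j = 0 := by
  induction j using Nat.strong_induction_on with
  | _ j ih =>
  set c : ℝ := τ * eps ^ 2 with hc
  have hc0 : 0 ≤ c := by positivity
  obtain ⟨k, hk, hkbig⟩ := ((eventually_sum_choose_mul_pow_ne_zero hc0 j).and
    (tendsto_natCast_atTop_atTop.eventually_gt_atTop (c + τ / (2 * η ^ 2)))).exists
  have hpos : 0 < τ / (2 * η ^ 2) := by positivity
  have hkc : 0 < (k : ℝ) - c := by linarith
  set lam : ℝ := √(τ / (2 * (k - c))) with hlam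
  have hlam0 : 0 < lam := Real.sqrt_pos.2 (by positivity)
  have hsq : lam ^ 2 = τ / (2 * (k - c)) := Real.sq_sqrt (by positivity)
  have hlamη : lam < η := by
    refine lt_of_pow_lt_pow_left₀ 2 hη.le ?_
    rw [hsq, div_lt_iff₀ (by positivity)]
    have h1 : τ / (2 * η ^ 2) < k - c := by linarith
    rw [div_lt_iff₀ (by positivity)] at h1
    linarith
  have hrel : τ * (1 / lam ^ 2 + 2 * eps ^ 2) = 2 * k := by
    rw [hsq, one_div_div, mul_add, mul_div_cancel₀ _ hτ.ne', hc]
    ring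
  have h := integral_fockWeight_mul_sum_eq_zero hlam0 hf (hI lam ⟨hlam0, hlamη⟩) hτ hrel α j
  obtain ⟨d, hd⟩ := sum_eq_leading_add_lower
    (fun m => ((k + j).choose (k + m) : ℂ) / (m.factorial : ℂ)) ((lam : ℂ)⁻¹ ^ 2) α (τ / 2) j
  have hlead : ∑ m ∈ Finset.range (j + 1), ((k + j).choose (k + m) : ℂ) / (m.factorial : ℂ) *
      (-((lam : ℂ)⁻¹ ^ 2 * (τ / 2))) ^ m ≠ 0 := by
    have h1 : -((lam : ℂ)⁻¹ ^ 2 * (τ / 2)) = ((c - k : ℝ) : ℂ) := by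
      have h2 : -(lam⁻¹ ^ 2 * (τ / 2)) = c - k := by
        rw [inv_pow, hsq]
        field_simp
        ring
      rw [← h2]; push_cast; ring
    rw [h1]
    refine fun h0 => hk (Complex.ofReal_eq_zero.1 ?_)
    push_cast at h0 ⊢
    exact h0
  have hfint := integrable_mul_fockWeight_mul_pow hf hτ α
  simp only [hd] at h
  have hsplit : ∀ q : ℂ × ℝ, f q * fockWeight τ α q *
      ((∑ m ∈ Finset.range (j + 1), ((k + j).choose (k + m) : ℂ) / (m.factorial : ℂ) *
        (-((lam : ℂ)⁻¹ ^ 2 * (τ / 2))) ^ m) * conj q.1 ^ j +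
        ∑ i ∈ Finset.range j, d i * conj q.1 ^ i) =
      (∑ m ∈ Finset.range (j + 1), ((k + j).choose (k + m) : ℂ) / (m.factorial : ℂ) *
        (-((lam : ℂ)⁻¹ ^ 2 * (τ / 2))) ^ m) * (f q * fockWeight τ α q * conj q.1 ^ j) +
        ∑ i ∈ Finset.range j, d i * (f q * fockWeight τ α q * conj q.1 ^ i) := by
    intro q
    rw [mul_add, Finset.mul_sum]
    congr 1
    · ring
    · exact Finset.sum_congr rfl fun i _ => by ring
  simp only [hsplit] at h
  have hlow : ∑ i ∈ Finset.range j, ∫ q, d i * (f q * fockWeight τ α q * conj q.1 ^ i) = 0 :=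
    Finset.sum_eq_zero fun i hi => by
      rw [integral_const_mul, ih i (Finset.mem_range.1 hi), mul_zero]
  rw [integral_add ((hfint j).const_mul _)
      (integrable_finsetSum _ fun i _ => (hfint i).const_mul _), integral_const_mul,
    integral_finsetSum _ fun i _ => (hfint i).const_mul _, hlow, add_zero] at h
  exact (mul_eq_zero.1 h).resolve_left hlead

theorem integral_mul_fockWeight_mul_exp_eq_zero {eps : ℝ} {f : ℂ × ℝ → ℂ} (hf : Integrable f)
    {η : ℝ} (hη : 0 < η)
    (hI : ∀ lam ∈ Set.Ioo (0 : ℝ) η, ∀ᵐ p : ℂ × ℝ, xrayE eps lam f p = 0) {τ : ℝ} (hτ : 0 < τ)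
    (α β : ℂ) : ∫ q, f q * fockWeight τ α q * cexp (β * conj q.1) = 0 := by
  have hcont := continuous_fockWeight τ α
  have hconj : Continuous fun q : ℂ × ℝ => conj q.1 :=
    Complex.continuous_conj.comp continuous_fst
  have key := hasSum_integral_of_dominated_convergence (μ := (volume : Measure (ℂ × ℝ)))
    (F := fun (n : ℕ) q => β ^ n / (n.factorial : ℂ) * (f q * fockWeight τ α q * conj q.1 ^ n))
    (f := fun q => f q * fockWeight τ α q * cexp (β * conj q.1))
    (fun n q => ‖f q * fockWeight τ α q‖ * ((‖β‖ * ‖q.1‖) ^ n / (n.factorial : ℝ)))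
    (fun n => ((integrable_mul_fockWeight_mul_pow hf hτ α n).const_mul _).aestronglyMeasurable)
    (fun n => ae_of_all _ fun q => ?_)
    (ae_of_all _ fun q => (Real.summable_pow_div_factorial _).mul_left _) ?_
    (ae_of_all _ fun q => ?_)
  · refine key.unique ?_
    convert! hasSum_zero (α := ℂ) (β := ℕ) using 2 with n
    rw [integral_const_mul, integral_mul_fockWeight_mul_pow_eq_zero hf hη hI hτ, mul_zero]
  · simp only [norm_mul, norm_div, norm_pow, Complex.norm_natCast, Complex.norm_conj, mul_pow]
    exact le_of_eq (by ring)
  · have hsum : ∀ q : ℂ × ℝ, ∑' n : ℕ, ‖f q * fockWeight τ α q‖ *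
        ((‖β‖ * ‖q.1‖) ^ n / (n.factorial : ℝ)) =
        ‖f q‖ * (‖fockWeight τ α q‖ * rexp (‖β‖ * ‖q.1‖)) := by
      intro q
      have h := (NormedSpace.expSeries_div_hasSum_exp (‖β‖ * ‖q.1‖)).mul_left
        ‖f q * fockWeight τ α q‖
      rw [← Real.exp_eq_exp_ℝ] at h
      rw [h.tsum_eq, norm_mul, mul_assoc]
    simp only [hsum]
    refine hf.norm.mul_bdd (c := rexp ((‖α‖ + ‖β‖) ^ 2 / τ))
      (Continuous.aestronglyMeasurable (by fun_prop)) (ae_of_all _ fun q => ?_)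
    rw [Real.norm_of_nonneg (by positivity), fockWeight, norm_mul, norm_exp_neg_I_mul, one_mul]
    calc _ ≤ rexp (-(τ / 4) * ‖q.1‖ ^ 2 + ‖α‖ * ‖q.1‖) * rexp (‖β‖ * ‖q.1‖) :=
          mul_le_mul_of_nonneg_right (norm_gaussian τ α q.1) (by positivity)
      _ = rexp (-(τ / 4) * ‖q.1‖ ^ 2 + (‖α‖ + ‖β‖) * ‖q.1‖) := by
          rw [← Real.exp_add]; ring_nf
      _ ≤ _ := exp_neg_sq_add_le hτ _ _
  · have h := (NormedSpace.expSeries_div_hasSum_exp (β * conj q.1)).mul_left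
      (f q * fockWeight τ α q)
    rw [← Complex.exp_eq_exp_ℂ] at h
    convert! h using 2 with n
    rw [mul_pow]
    ring

/-- The partial Fourier transform in the central variable vanishes at positive frequencies. -/
theorem ae_integral_exp_mul_eq_zero {eps : ℝ} {f : ℂ × ℝ → ℂ} (hf : Integrable f)
    {η : ℝ} (hη : 0 < η)
    (hI : ∀ lam ∈ Set.Ioo (0 : ℝ) η, ∀ᵐ p : ℂ × ℝ, xrayE eps lam f p = 0) {τ : ℝ} (hτ : 0 < τ) :
    ∀ᵐ z : ℂ, ∫ t : ℝ, f (z, t) * cexp (-(I * τ * t)) = 0 := by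
  set g : ℂ → ℂ := fun z => ∫ t : ℝ, f (z, t) * fockWeight τ 0 (z, t) with hg
  have hfint : Integrable fun q => f q * fockWeight τ 0 q := by
    simpa using integrable_mul_fockWeight_mul_pow hf hτ 0 0
  have hgint : Integrable g := hfint.integral_prod_left
  have hfour : ∀ ζ, 𝓕 g ζ = 0 := by
    intro ζ
    have h := integral_mul_fockWeight_mul_exp_eq_zero hf hη hI hτ (-(π * I * conj ζ))
      (-(π * I * ζ))
    have heq : ∀ q : ℂ × ℝ, f q * fockWeight τ (-(π * I * conj ζ)) q *
        cexp (-(π * I * ζ) * conj q.1) =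
        cexp (((-2 * π * inner ℝ q.1 ζ : ℝ) : ℂ) * I) * (f q * fockWeight τ 0 q) := by
      intro q
      have h1 : ((inner ℝ q.1 ζ : ℝ) : ℂ) = (ζ * conj q.1 + q.1 * conj ζ) / 2 := by
        rw [Complex.inner]
        apply Complex.ext <;> simp <;> ring
      have h2 : -(τ / 4 : ℂ) * (q.1 * conj q.1) + -(π * I * conj ζ) * q.1 +
          -(π * I * ζ) * conj q.1 = ((-2 * π * inner ℝ q.1 ζ : ℝ) : ℂ) * I +
          (-(τ / 4 : ℂ) * (q.1 * conj q.1) + 0 * q.1) := by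
        push_cast
        rw [h1]
        ring
      calc _ = f q * cexp (-(I * τ * q.2)) * cexp (-(τ / 4 : ℂ) * (q.1 * conj q.1) +
            -(π * I * conj ζ) * q.1 + -(π * I * ζ) * conj q.1) := by
            rw [fockWeight, Complex.exp_add (_ + _) (-(π * I * ζ) * _)]; ring
        _ = _ := by
            rw [h2, Complex.exp_add, fockWeight]; ring
    simp only [heq] at h
    have hfint' : Integrable fun q : ℂ × ℝ =>
        cexp (((-2 * π * inner ℝ q.1 ζ : ℝ) : ℂ) * I) * (f q * fockWeight τ 0 q) := by
      refine hfint.bdd_mul (c := 1) (Continuous.aestronglyMeasurable (by fun_prop))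
        (ae_of_all _ fun q => ?_)
      rw [Complex.norm_exp_ofReal_mul_I]
    rw [Measure.volume_eq_prod, integral_prod _ hfint'] at h
    rw [Real.fourier_eq']
    simpa only [integral_const_mul, smul_eq_mul] using h
  filter_upwards [ae_eq_zero_of_fourier_ae_eq_zero hgint (ae_of_all _ hfour)] with z hz
  have h1 : g z = (∫ t : ℝ, f (z, t) * cexp (-(I * τ * t))) *
      cexp (-(τ / 4) * (z * conj z) + 0 * z) := by
    simp only [hg, fockWeight, ← mul_assoc]
    rw [integral_mul_const]
  rw [h1] at hz
  exact (mul_eq_zero.1 hz).resolve_right (Complex.exp_ne_zero _)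

theorem xrayE_conj (eps lam : ℝ) (f : ℂ × ℝ → ℂ) (p : ℂ × ℝ) :
    xrayE eps lam (fun q => conj (f q)) p = conj (xrayE eps lam f p) :=
  integral_conj

/-- **Injectivity of the taming X-ray transform `I^ε`.**
If `ε > 0`, `f ∈ L¹(ℍ)`, and for some `η > 0` the transform `I^ε_λ f` vanishes
almost everywhere for every `λ ∈ (0, η)`, then `f = 0` almost everywhere. -/
theorem taming_xray_injective (eps : ℝ) (heps : 0 < eps)
    (f : ℂ × ℝ → ℂ) (hf : Integrable f)
    (η : ℝ) (hη : 0 < η)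
    (hI : ∀ lam ∈ Set.Ioo (0 : ℝ) η, ∀ᵐ p : ℂ × ℝ, xrayE eps lam f p = 0) :
    f =ᵐ[volume] 0 := by
  have hneg : ∀ τ : ℝ, τ < 0 → ∀ᵐ z : ℂ, ∫ t : ℝ, f (z, t) * cexp (-(I * τ * t)) = 0 := by
    intro τ hτ
    have hfc : Integrable fun q => conj (f q) :=
      (LinearIsometryEquiv.integrable_comp_iff Complex.conjLIE).2 hf
    have hIc : ∀ lam ∈ Set.Ioo (0 : ℝ) η, ∀ᵐ p : ℂ × ℝ,
        xrayE eps lam (fun q => conj (f q)) p = 0 := fun lam hl => by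
      filter_upwards [hI lam hl] with p hp
      rw [xrayE_conj, hp, map_zero]
    filter_upwards [ae_integral_exp_mul_eq_zero hfc hη hIc (neg_pos.2 hτ)] with z hz
    rw [← map_eq_zero (starRingEnd ℂ), ← integral_conj, ← hz]
    congr 1
    funext t
    rw [map_mul, ← Complex.exp_conj]
    simp
  set f' : ℂ × ℝ → ℂ := hf.aestronglyMeasurable.mk f with hf'
  have hf'm : StronglyMeasurable f' := hf.aestronglyMeasurable.stronglyMeasurable_mk
  have hff' : f =ᵐ[volume] f' := hf.aestronglyMeasurable.ae_eq_mk
  have hslice : ∀ᵐ z : ℂ, ∀ᵐ t : ℝ, f (z, t) = f' (z, t) := Measure.ae_ae_of_ae_prod hff'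
  have hne : ∀ᵐ ν : ℝ, ∀ᵐ z : ℂ, 𝓕 (fun t => f' (z, t)) ν = 0 := by
    filter_upwards [Measure.ae_ne volume 0] with ν hν
    have h1 : ∀ᵐ z : ℂ, ∫ t : ℝ, f (z, t) * cexp (-(I * (2 * π * ν : ℝ) * t)) = 0 := by
      rcases lt_or_gt_of_ne hν with h | h
      · exact hneg _ (mul_neg_of_pos_of_neg (by positivity) h)
      · exact ae_integral_exp_mul_eq_zero hf hη hI (by positivity)
    filter_upwards [h1, hslice] with z hz hzs
    rw [Real.fourier_real_eq_integral_exp_smul, ← hz]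
    refine integral_congr_ae ?_
    filter_upwards [hzs] with t ht
    rw [ht, smul_eq_mul, mul_comm]
    congr 2
    push_cast
    ring
  have hjm : StronglyMeasurable (fun x : ℝ × ℂ => 𝓕 (fun t => f' (x.2, t)) x.1) := by
    simp only [Real.fourier_real_eq_integral_exp_smul]
    have hc : Continuous fun y : (ℝ × ℂ) × ℝ => cexp (((-2 * π * y.2 * y.1.1 : ℝ) : ℂ) * I) := by
      fun_prop
    have h2 : StronglyMeasurable fun y : (ℝ × ℂ) × ℝ => f' (y.1.2, y.2) :=
      hf'm.comp_measurable (by fun_prop)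
    exact (hc.stronglyMeasurable.smul h2).integral_prod_right'
  have hswap : ∀ᵐ z : ℂ, ∀ᵐ ν : ℝ, 𝓕 (fun t => f' (z, t)) ν = 0 :=
    (Measure.ae_ae_comm (p := fun ν z => 𝓕 (fun t => f' (z, t)) ν = 0)
      (hjm.measurable (measurableSet_singleton 0))).1 hne
  have hfint : Integrable f' (volume.prod volume) := hf.congr hff'
  have hzero : ∀ᵐ z : ℂ, ∀ᵐ t : ℝ, f' (z, t) = 0 := by
    filter_upwards [hswap, hfint.prod_right_ae] with z hz hzi
    exact ae_eq_zero_of_fourier_ae_eq_zero hzi hz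
  exact hff'.trans
    ((Measure.ae_prod_iff_ae_ae (hf'm.measurable (measurableSet_singleton 0))).2 hzero)

end
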